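/- arXiv:1209.4791 — 2 statements merged into one kernel-verified Lean document; each statement's English description precedes it below -/
import Mathlib

section
/- There exists a group homomorphism φ : FreeGroup (Fin 2) →* MulAut (QuaternionGroup 2) such that the commutator subgroup of B₄(S²) is isomorphic to the semidirect product (QuaternionGroup 2) ⋊_φ FreeGroup (Fin 2). In other words, Γ₂(B₄(S²)) ≅ Q₈ ⋊ F₂, a quaternion group of order 8 extended by a free group of rank 2 with a splitting. -/
/-- The defining relators of the sphere braid group `B₄(S²)` on generators
`σ₁ = of 0`, `σ₂ = of 1`, `σ₃ = of 2`:
`σ₁σ₃ = σ₃σ₁`, `σ₁σ₂σ₁ = σ₂σ₁σ₂`, `σ₂σ₃σ₂ = σ₃σ₂σ₃`, `σ₁σ₂σ₃²σ₂σ₁ = 1`. -/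
def sphereBraidRels : Set (FreeGroup (Fin 3)) :=
  { FreeGroup.of 0 * FreeGroup.of 2 * (FreeGroup.of 2 * FreeGroup.of 0)⁻¹,
    FreeGroup.of 0 * FreeGroup.of 1 * FreeGroup.of 0 *
      (FreeGroup.of 1 * FreeGroup.of 0 * FreeGroup.of 1)⁻¹,
    FreeGroup.of 1 * FreeGroup.of 2 * FreeGroup.of 1 *
      (FreeGroup.of 2 * FreeGroup.of 1 * FreeGroup.of 2)⁻¹,
    FreeGroup.of 0 * FreeGroup.of 1 * FreeGroup.of 2 ^ 2 * FreeGroup.of 1 * FreeGroup.of 0 }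

/-- The braid group `B₄(S²)` of the sphere on four strings, as a presented group. -/
abbrev B4S2 : Type := PresentedGroup sphereBraidRels

/-- The generator `σᵢ₊₁` of `B₄(S²)`. -/
def σ (i : Fin 3) : B4S2 := PresentedGroup.of i

theorem FreeGroup.eq_one_of_forall_mul_comm {α : Type*} [Nontrivial α] {w : FreeGroup α}
    (hw : ∀ g, g * w = w * g) : w = 1 := by
  classical
  by_contra hne
  have hL : w.toWord ≠ [] := by simpa using hne
  obtain ⟨p, L, hpL⟩ := List.exists_cons_of_ne_nil hL
  obtain ⟨j, hj⟩ := exists_ne p.1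
  set m : α × Bool := (j, (w.toWord.getLast hL).2) with hm
  have hred := FreeGroup.isReduced_toWord (x := w)
  have hleft : FreeGroup.IsReduced (m :: w.toWord) := by
    rw [hpL] at hred ⊢
    exact FreeGroup.isReduced_cons_cons.2 ⟨fun h => absurd h hj, hred⟩
  have hright : FreeGroup.IsReduced (w.toWord ++ [m]) := by
    refine List.isChain_append.2 ⟨hred, List.isChain_singleton _, ?_⟩
    intro x hx y hy
    simp only [List.getLast?_eq_some_getLast hL, Option.mem_some_iff, List.head?_cons] at hx hy
    subst hx hy
    simp [hm]
  have h := congrArg FreeGroup.toWord (hw (FreeGroup.mk [m]))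
  rw [← FreeGroup.mk_toWord (x := w), FreeGroup.mul_mk, FreeGroup.mul_mk, FreeGroup.toWord_mk,
    FreeGroup.toWord_mk, List.singleton_append, hleft.reduce_eq, hright.reduce_eq, hpL,
    List.cons_append, List.cons.injEq] at h
  exact hj (congrArg Prod.fst h.1)

theorem FreeGroup.conj_injective {α : Type*} [Nontrivial α] :
    Function.Injective (MulAut.conj : FreeGroup α →* MulAut (FreeGroup α)) := by
  refine (injective_iff_map_eq_one _).2 fun w hw => FreeGroup.eq_one_of_forall_mul_comm fun g => ?_
  have := DFunLike.congr_fun hw g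
  rw [MulAut.conj_apply, MulAut.one_apply, mul_inv_eq_iff_eq_mul] at this
  exact this.symm

namespace Subgroup

variable {G : Type*} [Group G]

theorem conj_mem_closure {S : Set G} {g : G} (h : ∀ s ∈ S, g * s * g⁻¹ ∈ closure S) {x : G}
    (hx : x ∈ closure S) : g * x * g⁻¹ ∈ closure S := by
  have : closure S ≤ (closure S).comap (MulAut.conj g).toMonoidHom :=
    (closure_le _).2 fun s hs => h s hs
  exact this hx

theorem inv_conj_mem {H : Subgroup G} {g x z : G} (hz : z ∈ H) (h : g * z * g⁻¹ = x) :
    g⁻¹ * x * g ∈ H := by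
  rwa [← h, mul_assoc, inv_mul_cancel_right, inv_mul_cancel_left]

/-- If each element of a generating set `T` conjugates `S` into `closure S`, in both directions,
then `closure S` is normal. -/
theorem normal_closure_of_conj_mem {S T : Set G} (hT : closure T = ⊤)
    (h : ∀ t ∈ T, ∀ s ∈ S, t * s * t⁻¹ ∈ closure S ∧ t⁻¹ * s * t ∈ closure S) :
    (closure S).Normal := by
  rw [← normalizer_eq_top_iff, eq_top_iff, ← hT, closure_le]
  intro t ht
  refine mem_normalizer_iff.2 fun x => ⟨conj_mem_closure fun s hs => (h t ht s hs).1, fun hx => ?_⟩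
  have := conj_mem_closure (g := t⁻¹) (fun s hs => by simpa using (h t ht s hs).2) hx
  simpa [mul_assoc] using this

end Subgroup

section BraidRelations

variable {G : Type*} [Group G] {s t u : G}

theorem braid_conj (h : s * t * s = t * s * t) : s * (t * s⁻¹) * s⁻¹ = (s⁻¹ * t)⁻¹ * (t * s⁻¹) :=
  calc s * (t * s⁻¹) * s⁻¹ = t⁻¹ * (t * s * t) * s⁻¹ * s⁻¹ := by group
    _ = t⁻¹ * (s * t * s) * s⁻¹ * s⁻¹ := by rw [h]
    _ = (s⁻¹ * t)⁻¹ * (t * s⁻¹) := by group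

theorem braid_conj_right {a b : G} (hst : s * t * s = t * s * t) (ha : Commute s a)
    (hb : t * a * t⁻¹ = b) (hsb : s * b * s⁻¹ = b * a⁻¹) :
    t * b * t⁻¹ = b * a⁻¹ * b := by
  have h : t * (s * b * s⁻¹) * t⁻¹ = s * b * s⁻¹ :=
    calc t * (s * b * s⁻¹) * t⁻¹ = (t * s * t) * a * (t * s * t)⁻¹ := by rw [← hb]; group
      _ = s * t * (s * a) * (s * t * s)⁻¹ := by rw [← hst]; group
      _ = s * (t * a * t⁻¹) * s⁻¹ := by rw [ha.eq]; group
      _ = s * b * s⁻¹ := by rw [hb]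
  calc t * b * t⁻¹ = t * (b * a⁻¹) * t⁻¹ * (t * a * t⁻¹) := by group
    _ = b * a⁻¹ * b := by rw [← hsb, h, hb, hsb]

theorem braid_half_twist_conj {a b : G} (hst : s * t * s = t * s * t) (ha : Commute s a)
    (hb : t * a * t⁻¹ = b) (hsb : s * b * s⁻¹ = b * a⁻¹) :
    (s * t * s) * a * (s * t * s)⁻¹ = b * a⁻¹ ∧
      (s * t * s) * b * (s * t * s)⁻¹ = b * a⁻¹ * a⁻¹ := by
  have hsa : s * a * s⁻¹ = a := by rw [ha.eq, mul_inv_cancel_right]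
  have htb := braid_conj_right hst ha hb hsb
  simp only [← MulAut.conj_apply, map_mul, MulAut.mul_apply] at hsa hb hsb htb ⊢
  simp only [hsa, hb, hsb, htb, map_mul, map_inv, true_and]
  group

end BraidRelations

theorem eq_of_braid_rel {A : Type*} [CommGroup A] {x y : A} (h : x * y * x = y * x * y) :
    x = y :=
  mul_left_cancel (a := x * y) (by rw [h, mul_comm x y])

namespace B4S2

theorem commute_σ : Commute (σ 0) (σ 2) :=
  PresentedGroup.mk_eq_mk_of_mul_inv_mem (by simp [sphereBraidRels])

theorem braid_left : σ 0 * σ 1 * σ 0 = σ 1 * σ 0 * σ 1 :=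
  PresentedGroup.mk_eq_mk_of_mul_inv_mem (by simp [sphereBraidRels])

theorem braid_right : σ 1 * σ 2 * σ 1 = σ 2 * σ 1 * σ 2 :=
  PresentedGroup.mk_eq_mk_of_mul_inv_mem (by simp [sphereBraidRels])

theorem sphere_rel : σ 0 * σ 1 * σ 2 ^ 2 * σ 1 * σ 0 = 1 :=
  PresentedGroup.one_of_mem (by simp [sphereBraidRels])

section lift

variable {G : Type*} [Group G] {x y z : G} (h₁ : x * z = z * x) (h₂ : x * y * x = y * x * y)
  (h₃ : y * z * y = z * y * z) (h₄ : x * y * z ^ 2 * y * x = 1)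

/-- The homomorphism from `B₄(S²)` to a group sending `σ₁`, `σ₂`, `σ₃` to elements satisfying the
defining relations. -/
def lift : B4S2 →* G :=
  PresentedGroup.toGroup (f := ![x, y, z]) <| by
    rintro r (rfl | rfl | rfl | rfl)
    all_goals simp only [map_mul, map_inv, map_pow, FreeGroup.lift_apply_of, Matrix.cons_val]
    exacts [mul_inv_eq_one.2 h₁, mul_inv_eq_one.2 h₂, mul_inv_eq_one.2 h₃, h₄]

@[simp]
theorem lift_σ_zero : lift h₁ h₂ h₃ h₄ (σ 0) = x :=
  PresentedGroup.toGroup.of _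

@[simp]
theorem lift_σ_one : lift h₁ h₂ h₃ h₄ (σ 1) = y :=
  PresentedGroup.toGroup.of _

@[simp]
theorem lift_σ_two : lift h₁ h₂ h₃ h₄ (σ 2) = z :=
  PresentedGroup.toGroup.of _

end lift

/-- The first generator of the quaternion subgroup of `B₄(S²)`. -/
def quatA : B4S2 := σ 0 * (σ 2)⁻¹

/-- The second generator of the quaternion subgroup of `B₄(S²)`. -/
def quatB : B4S2 := σ 1 * quatA * (σ 1)⁻¹

/-- The first generator of the free complement. -/
def freeX : B4S2 := (σ 0)⁻¹ * σ 1

/-- The second generator of the free complement. -/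
def freeY : B4S2 := σ 1 * (σ 0)⁻¹

theorem commute_σ_zero_quatA : Commute (σ 0) quatA :=
  (Commute.refl _).mul_right commute_σ.inv_right

theorem σ_zero_conj_quatB : σ 0 * quatB * (σ 0)⁻¹ = quatB * quatA⁻¹ := by
  have h : σ 1 * (σ 2)⁻¹ * (σ 1)⁻¹ = (σ 2)⁻¹ * (σ 1)⁻¹ * σ 2 :=
    calc σ 1 * (σ 2)⁻¹ * (σ 1)⁻¹
        = (σ 2)⁻¹ * (σ 1)⁻¹ * (σ 1 * σ 2 * σ 1) * (σ 2)⁻¹ * (σ 1)⁻¹ := by group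
      _ = (σ 2)⁻¹ * (σ 1)⁻¹ * σ 2 := by rw [braid_right]; group
  calc σ 0 * quatB * (σ 0)⁻¹
      = (σ 0 * σ 1 * σ 0) * (σ 2)⁻¹ * (σ 1)⁻¹ * (σ 0)⁻¹ := by rw [quatB, quatA]; group
    _ = σ 1 * σ 0 * (σ 1 * (σ 2)⁻¹ * (σ 1)⁻¹) * (σ 0)⁻¹ := by rw [braid_left]; group
    _ = quatB * (σ 2 * (σ 0)⁻¹) := by rw [h, quatB, quatA]; group
    _ = quatB * quatA⁻¹ := by rw [quatA, mul_inv_rev, inv_inv]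

theorem σ_zero_conj_quatA : σ 0 * quatA * (σ 0)⁻¹ = quatA := by
  rw [commute_σ_zero_quatA.eq, mul_inv_cancel_right]

theorem σ_one_conj_quatB : σ 1 * quatB * (σ 1)⁻¹ = quatB * quatA⁻¹ * quatB :=
  braid_conj_right braid_left commute_σ_zero_quatA rfl σ_zero_conj_quatB

theorem half_twist_sq :
    (σ 0 * σ 1 * σ 0) ^ 2 = quatA ^ 2 ∧ Commute (σ 1) (quatA ^ 2) := by
  have hu : σ 2 = quatA⁻¹ * σ 0 := by
    rw [quatA, mul_inv_rev, inv_inv, inv_mul_cancel_right]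
  have hu2 : σ 2 ^ 2 = σ 0 ^ 2 * (quatA ^ 2)⁻¹ := by
    rw [hu, commute_σ_zero_quatA.symm.inv_left.mul_pow, inv_pow,
      ((commute_σ_zero_quatA.pow_pow 2 2).inv_right).eq]
  have h0 : σ 0 * (σ 0 * σ 1 * σ 0) = (σ 0 * σ 1 * σ 0) * σ 1 := by
    nth_rw 1 [braid_left]; group
  have h1 : σ 1 * (σ 0 * σ 1 * σ 0) = (σ 0 * σ 1 * σ 0) * σ 0 := by
    nth_rw 2 [braid_left]; group
  have hc : Commute (σ 0) ((σ 0 * σ 1 * σ 0) ^ 2) ∧ Commute (σ 1) ((σ 0 * σ 1 * σ 0) ^ 2) := by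
    generalize σ 0 * σ 1 * σ 0 = d at h0 h1
    rw [sq]
    constructor
    · rw [Commute, SemiconjBy, ← mul_assoc, h0, mul_assoc, h1, mul_assoc]
    · rw [Commute, SemiconjBy, ← mul_assoc, h1, mul_assoc, h0, mul_assoc]
  have hr : (σ 0 * σ 1 * σ 0) ^ 2 * ((σ 1 * σ 0)⁻¹ * (quatA ^ 2)⁻¹ * (σ 1 * σ 0)) = 1 := by
    rw [← sphere_rel, hu2, sq, sq (σ 0)]; group
  have hD : (σ 0 * σ 1 * σ 0) ^ 2 = quatA ^ 2 :=
    calc (σ 0 * σ 1 * σ 0) ^ 2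
        = σ 1 * σ 0 * (σ 0 * σ 1 * σ 0) ^ 2 * (σ 1 * σ 0)⁻¹ := by
          rw [(hc.2.mul_left hc.1).eq, mul_inv_cancel_right]
      _ = σ 1 * σ 0 * ((σ 0 * σ 1 * σ 0) ^ 2 * ((σ 1 * σ 0)⁻¹ * (quatA ^ 2)⁻¹ * (σ 1 * σ 0))) *
          (σ 1 * σ 0)⁻¹ * quatA ^ 2 := by group
      _ = quatA ^ 2 := by rw [hr]; group
  exact ⟨hD, hD ▸ hc.2⟩

theorem quatB_sq : quatB ^ 2 = quatA ^ 2 := by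
  rw [quatB, conj_pow, half_twist_sq.2.eq, mul_inv_cancel_right]

theorem quatA_mul_quatB : quatA * quatB = quatB * quatA⁻¹ := by
  obtain ⟨h₁, h₂⟩ :=
    braid_half_twist_conj (b := quatB) braid_left commute_σ_zero_quatA rfl σ_zero_conj_quatB
  have h : quatA ^ 2 * quatA * (quatA ^ 2)⁻¹ = quatB * quatA⁻¹ * quatB⁻¹ :=
    calc quatA ^ 2 * quatA * (quatA ^ 2)⁻¹
        = σ 0 * σ 1 * σ 0 * (σ 0 * σ 1 * σ 0 * quatA * (σ 0 * σ 1 * σ 0)⁻¹) *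
          (σ 0 * σ 1 * σ 0)⁻¹ := by rw [← half_twist_sq.1, sq]; group
      _ = σ 0 * σ 1 * σ 0 * (quatB * quatA⁻¹) * (σ 0 * σ 1 * σ 0)⁻¹ := by rw [h₁]
      _ = (σ 0 * σ 1 * σ 0 * quatB * (σ 0 * σ 1 * σ 0)⁻¹) *
          (σ 0 * σ 1 * σ 0 * quatA * (σ 0 * σ 1 * σ 0)⁻¹)⁻¹ := by group
      _ = quatB * quatA⁻¹ * quatB⁻¹ := by rw [h₂, h₁]; group
  rw [← eq_mul_inv_iff_mul_eq, ← h]; group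

theorem quatA_pow_four : quatA ^ 4 = 1 := by
  have h : quatA ^ 2 = (quatA ^ 2)⁻¹ :=
    calc quatA ^ 2 = (quatB * quatA⁻¹ * quatB⁻¹) ^ 2 := by
          rw [← quatA_mul_quatB, mul_inv_cancel_right]
      _ = quatB * (quatB ^ 2)⁻¹ * quatB⁻¹ := by rw [conj_pow, inv_pow, quatB_sq]
      _ = (quatA ^ 2)⁻¹ := by rw [← quatB_sq]; group
  rw [show 4 = 2 + 2 from rfl, pow_add]
  exact mul_eq_one_iff_eq_inv.2 h

theorem σ_zero_conj_freeY : σ 0 * freeY * (σ 0)⁻¹ = freeX⁻¹ * freeY :=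
  braid_conj braid_left

/-- The embedding of the quaternion group in `B₄(S²)`. -/
def quat : QuaternionGroup 2 →* B4S2 where
  toFun
    | .a i => quatA ^ i.val
    | .xa i => quatB * quatA ^ i.val
  map_one' := pow_zero _
  map_mul' := by
    have hadd (i j : ZMod (2 * 2)) : quatA ^ (i + j).val = quatA ^ i.val * quatA ^ j.val := by
      rw [ZMod.val_add, ← pow_add]
      exact (pow_eq_pow_mod _ quatA_pow_four).symm
    have hneg (i : ZMod (2 * 2)) : quatA ^ (-i).val = (quatA ^ i.val)⁻¹ := by
      rw [eq_inv_iff_mul_eq_one, ← hadd, neg_add_cancel, ZMod.val_zero, pow_zero]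
    have hcomm (i : ZMod (2 * 2)) : quatA ^ i.val * quatB = quatB * quatA ^ (-i).val := by
      rw [hneg, ← inv_pow]
      exact (SemiconjBy.pow_right (a := quatB) (quatA_mul_quatB.symm) i.val).symm
    have htwo : quatA ^ ((2 : ℕ) : ZMod (2 * 2)).val = quatB ^ 2 := quatB_sq.symm
    rintro (i | i) (j | j)
    · simp [hadd]
    · simp only [QuaternionGroup.a_mul_xa, sub_eq_neg_add, hadd, ← mul_assoc, hcomm]
    · simp [hadd, mul_assoc]
    · simp only [QuaternionGroup.xa_mul_xa, sub_eq_add_neg, add_assoc, hadd, htwo]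
      rw [pow_mul_comm, mul_assoc quatB, ← mul_assoc _ quatB, hcomm, sq]
      simp only [mul_assoc]

theorem quat_a_one : quat (.a 1) = quatA := pow_one _

theorem quat_xa_zero : quat (.xa 0) = quatB := by
  change quatB * quatA ^ 0 = quatB
  simp

/-- The image of `B₄(S²)` in `SL₂(𝔽₇)`, which is the binary octahedral group. -/
def toSL : B4S2 →* Matrix.SpecialLinearGroup (Fin 2) (ZMod 7) :=
  lift (x := ⟨!![1, 1; 1, 2], by decide⟩) (y := ⟨!![5, 5; 2, 5], by decide⟩)
    (z := ⟨!![2, -1; -1, 1], by decide⟩) (by decide) (by decide) (by decide) (by decide)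

theorem quatA_sq_ne_one : quatA ^ 2 ≠ 1 := by
  intro h
  have h' := congrArg toSL h
  simp only [quatA, map_pow, map_mul, map_inv, map_one] at h'
  revert h'
  decide

theorem quat_injective : Function.Injective quat := by
  refine (injective_iff_map_eq_one _).2 fun q hq => ?_
  have hcases : ∀ q : QuaternionGroup 2, q = 1 ∨ q = .a 1 ^ 2 ∨ q ^ 2 = .a 1 ^ 2 := by decide
  have hA : quat (.a 1 ^ 2) ≠ 1 := by rw [map_pow, quat_a_one]; exact quatA_sq_ne_one
  obtain h | h | h := hcases q
  · exact h
  · exact absurd (h ▸ hq) hA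
  · exact absurd (by rw [← h, map_pow, hq, one_pow]) hA

theorem closure_σ {T : Set B4S2} (h : ∀ i, σ i ∈ Subgroup.closure T) :
    Subgroup.closure T = ⊤ := by
  rw [eq_top_iff, ← PresentedGroup.closure_range_of, Subgroup.closure_le]
  rintro _ ⟨i, rfl⟩
  exact h i

theorem closure_quat : Subgroup.closure {quatA, quatB} = quat.range := by
  apply le_antisymm
  · rw [Subgroup.closure_le]
    rintro _ (rfl | rfl)
    exacts [⟨_, quat_a_one⟩, ⟨_, quat_xa_zero⟩]
  · have hA : quatA ∈ Subgroup.closure {quatA, quatB} := Subgroup.subset_closure (by simp)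
    have hB : quatB ∈ Subgroup.closure {quatA, quatB} := Subgroup.subset_closure (by simp)
    rintro _ ⟨i | i, rfl⟩
    exacts [pow_mem hA _, mul_mem hB (pow_mem hA _)]

theorem closure_σ_freeX_quatA : Subgroup.closure {σ 0, freeX, quatA} = ⊤ := by
  have h0 : σ 0 ∈ Subgroup.closure {σ 0, freeX, quatA} := Subgroup.subset_closure (by simp)
  have hX : freeX ∈ Subgroup.closure {σ 0, freeX, quatA} := Subgroup.subset_closure (by simp)
  have hA : quatA ∈ Subgroup.closure {σ 0, freeX, quatA} := Subgroup.subset_closure (by simp)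
  refine closure_σ fun i => ?_
  fin_cases i
  · exact h0
  · have := mul_mem h0 hX
    rwa [freeX, mul_inv_cancel_left] at this
  · have := mul_mem (inv_mem hA) h0
    rwa [quatA, mul_inv_rev, inv_inv, inv_mul_cancel_right] at this

theorem closure_σ_zero_one_quatA : Subgroup.closure {σ 0, σ 1, quatA} = ⊤ := by
  rw [eq_top_iff, ← closure_σ_freeX_quatA, Subgroup.closure_le]
  have h0 : σ 0 ∈ Subgroup.closure {σ 0, σ 1, quatA} := Subgroup.subset_closure (by simp)
  rintro _ (rfl | rfl | rfl)
  · exact h0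
  · exact mul_mem (inv_mem h0) (Subgroup.subset_closure (by simp))
  · exact Subgroup.subset_closure (by simp)

instance : quat.range.Normal := by
  rw [← closure_quat]
  have hA : quatA ∈ Subgroup.closure {quatA, quatB} := Subgroup.subset_closure (by simp)
  have hB : quatB ∈ Subgroup.closure {quatA, quatB} := Subgroup.subset_closure (by simp)
  refine Subgroup.normal_closure_of_conj_mem closure_σ_zero_one_quatA ?_
  rintro _ (rfl | rfl | rfl) _ (rfl | rfl)
  · exact ⟨by rwa [σ_zero_conj_quatA], Subgroup.inv_conj_mem hA σ_zero_conj_quatA⟩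
  · refine ⟨σ_zero_conj_quatB ▸ mul_mem hB (inv_mem hA),
      Subgroup.inv_conj_mem (mul_mem hB hA) ?_⟩
    rw [← conj_mul, σ_zero_conj_quatA, σ_zero_conj_quatB, inv_mul_cancel_right]
  · refine ⟨hB, Subgroup.inv_conj_mem (mul_mem (mul_mem hA (inv_mem hB)) hA) ?_⟩
    rw [← conj_mul, ← conj_mul, ← conj_inv, σ_one_conj_quatB, ← quatB]
    group
  · refine ⟨σ_one_conj_quatB ▸ mul_mem (mul_mem hB (inv_mem hA)) hB,
      Subgroup.inv_conj_mem hA rfl⟩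
  · exact ⟨mul_mem (mul_mem hA hA) (inv_mem hA), mul_mem (mul_mem (inv_mem hA) hA) hA⟩
  · exact ⟨mul_mem (mul_mem hA hB) (inv_mem hA), mul_mem (mul_mem (inv_mem hA) hB) hA⟩

/-- The homomorphism from the free group splitting the commutator subgroup of `B₄(S²)` modulo the
quaternion subgroup. -/
def free : FreeGroup (Fin 2) →* B4S2 := FreeGroup.lift ![freeX, freeY]

theorem free_of_zero : free (.of 0) = freeX := FreeGroup.lift_apply_of ..

theorem free_of_one : free (.of 1) = freeY := FreeGroup.lift_apply_of ..

/-- The subgroup generated by the quaternion subgroup and the free complement. -/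
def quatFree : Subgroup B4S2 := Subgroup.closure {quatA, quatB, freeX, freeY}

theorem quatA_mem : quatA ∈ quatFree := Subgroup.subset_closure (by simp)

theorem quatB_mem : quatB ∈ quatFree := Subgroup.subset_closure (by simp)

theorem freeX_mem : freeX ∈ quatFree := Subgroup.subset_closure (by simp)

theorem freeY_mem : freeY ∈ quatFree := Subgroup.subset_closure (by simp)

theorem σ_zero_conj_freeX : σ 0 * freeX * (σ 0)⁻¹ = freeY := by
  rw [freeX, mul_inv_cancel_left, freeY]

instance : quatFree.Normal := by
  refine Subgroup.normal_closure_of_conj_mem closure_σ_freeX_quatA fun t ht x hx => ?_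
  have hx' : x ∈ quatFree := Subgroup.subset_closure hx
  have hmem {t : B4S2} (ht : t ∈ quatFree) : t * x * t⁻¹ ∈ quatFree ∧ t⁻¹ * x * t ∈ quatFree :=
    ⟨mul_mem (mul_mem ht hx') (inv_mem ht), mul_mem (mul_mem (inv_mem ht) hx') ht⟩
  obtain rfl | rfl | rfl := ht
  · obtain rfl | rfl | rfl | rfl := hx
    · exact ⟨by rwa [σ_zero_conj_quatA], Subgroup.inv_conj_mem hx' σ_zero_conj_quatA⟩
    · refine ⟨σ_zero_conj_quatB ▸ mul_mem hx' (inv_mem quatA_mem),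
        Subgroup.inv_conj_mem (mul_mem hx' quatA_mem) ?_⟩
      rw [← conj_mul, σ_zero_conj_quatA, σ_zero_conj_quatB, inv_mul_cancel_right]
    · refine ⟨by rw [σ_zero_conj_freeX]; exact freeY_mem,
        Subgroup.inv_conj_mem (mul_mem hx' (inv_mem freeY_mem)) ?_⟩
      rw [← conj_mul, ← conj_inv, σ_zero_conj_freeX, σ_zero_conj_freeY]
      group
    · exact ⟨σ_zero_conj_freeY ▸ mul_mem (inv_mem freeX_mem) hx',
        Subgroup.inv_conj_mem freeX_mem σ_zero_conj_freeX⟩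
  · exact hmem freeX_mem
  · exact hmem quatA_mem

theorem commutator_le_quatFree : commutator B4S2 ≤ quatFree := by
  have htop : Subgroup.zpowers (QuotientGroup.mk' quatFree (σ 0)) = ⊤ := by
    rw [← Subgroup.map_top_of_surjective _ (QuotientGroup.mk'_surjective quatFree),
      ← closure_σ_freeX_quatA, eq_comm, MonoidHom.map_closure]
    apply le_antisymm
    · rw [Subgroup.closure_le]
      rintro _ ⟨_, rfl | rfl | rfl, rfl⟩
      · exact Subgroup.mem_zpowers _
      · have : QuotientGroup.mk' quatFree freeX = 1 := (QuotientGroup.eq_one_iff _).2 freeX_mem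
        rw [this]; exact one_mem _
      · have : QuotientGroup.mk' quatFree quatA = 1 := (QuotientGroup.eq_one_iff _).2 quatA_mem
        rw [this]; exact one_mem _
    · rw [Subgroup.zpowers_le]
      exact Subgroup.subset_closure ⟨_, by simp, rfl⟩
  have : IsCyclic (B4S2 ⧸ quatFree) := ⟨_, fun x => htop ▸ Subgroup.mem_top x⟩
  let : CommGroup (B4S2 ⧸ quatFree) := IsCyclic.commGroup
  simpa using Abelianization.commutator_subset_ker (QuotientGroup.mk' quatFree)

theorem abelianization_σ_one : Abelianization.of (σ 1) = Abelianization.of (σ 0) :=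
  (eq_of_braid_rel (by simpa using congrArg Abelianization.of braid_left)).symm

theorem abelianization_σ_two : Abelianization.of (σ 2) = Abelianization.of (σ 0) :=
  (eq_of_braid_rel (by simpa using congrArg Abelianization.of braid_right)).symm.trans
    abelianization_σ_one

theorem quatFree_le_commutator : quatFree ≤ commutator B4S2 := by
  rw [quatFree, Subgroup.closure_le, ← Abelianization.ker_of]
  rintro _ (rfl | rfl | rfl | rfl) <;> rw [SetLike.mem_coe, MonoidHom.mem_ker] <;>
    simp [quatA, quatB, freeX, freeY, abelianization_σ_one, abelianization_σ_two]

/-- The automorphism of the free group induced by conjugation by `σ₁`. -/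
def freeAut : MulAut (FreeGroup (Fin 2)) :=
  MonoidHom.toMulEquiv (FreeGroup.lift ![.of 1, (.of 0)⁻¹ * .of 1])
    (FreeGroup.lift ![.of 0 * (.of 1)⁻¹, .of 0])
    (by ext i; fin_cases i <;> simp) (by ext i; fin_cases i <;> simp)

@[simp]
theorem freeAut_of_zero : freeAut (.of 0) = .of 1 := by simp [freeAut]

@[simp]
theorem freeAut_of_one : freeAut (.of 1) = (.of 0)⁻¹ * .of 1 := by
  simp [freeAut]

theorem mulAut_free_ext {f g : MulAut (FreeGroup (Fin 2))} (h₀ : f (.of 0) = g (.of 0))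
    (h₁ : f (.of 1) = g (.of 1)) : f = g := by
  have : f.toMonoidHom = g.toMonoidHom := by
    ext i
    fin_cases i
    exacts [h₀, h₁]
  exact MulEquiv.toMonoidHom_injective this

theorem freeAut_braid :
    freeAut * (freeAut * MulAut.conj (.of 0)) * freeAut =
      freeAut * MulAut.conj (.of 0) * freeAut * (freeAut * MulAut.conj (.of 0)) := by
  apply mulAut_free_ext <;> simp [mul_assoc]

theorem freeAut_sphere :
    freeAut * (freeAut * MulAut.conj (.of 0)) * freeAut ^ 2 * (freeAut * MulAut.conj (.of 0)) *
      freeAut = 1 := by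
  apply mulAut_free_ext <;> simp [mul_assoc, sq]

/-- The action of `B₄(S²)` on the free group. -/
def toMulAutFree : B4S2 →* MulAut (FreeGroup (Fin 2)) :=
  lift rfl freeAut_braid freeAut_braid.symm freeAut_sphere

theorem toMulAutFree_quat (q : QuaternionGroup 2) : toMulAutFree (quat q) = 1 := by
  have hA : toMulAutFree quatA = 1 := by simp [toMulAutFree, quatA]
  have hB : toMulAutFree quatB = 1 := by simp [quatB, hA]
  have : quat.range ≤ toMulAutFree.ker := by
    rw [← closure_quat, Subgroup.closure_le]
    rintro _ (rfl | rfl)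
    exacts [hA, hB]
  exact this ⟨q, rfl⟩

theorem toMulAutFree_free (w : FreeGroup (Fin 2)) : toMulAutFree (free w) = MulAut.conj w := by
  have : toMulAutFree.comp free = MulAut.conj := by
    ext1 i
    fin_cases i
    · simp [free_of_zero, freeX, toMulAutFree]
    · change toMulAutFree (free (.of 1)) = _
      simp only [free_of_one, freeY, toMulAutFree, map_mul, map_inv, lift_σ_zero, lift_σ_one]
      rw [mul_inv_eq_iff_eq_mul]
      apply mulAut_free_ext <;> simp
  exact DFunLike.congr_fun this w

/-- The quaternion group as a normal subgroup of `B₄(S²)`. -/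
noncomputable def quatEquiv : QuaternionGroup 2 ≃* quat.range :=
  MonoidHom.ofInjective quat_injective

/-- The action of the free complement on the quaternion group by conjugation. -/
noncomputable def quatAction : FreeGroup (Fin 2) →* MulAut (QuaternionGroup 2) :=
  ((MulAut.congr quatEquiv.symm).toMonoidHom.comp MulAut.conjNormal).comp free

theorem quat_quatAction (w : FreeGroup (Fin 2)) (q : QuaternionGroup 2) :
    quat (quatAction w q) = free w * quat q * (free w)⁻¹ := by
  have h (p : quat.range) : quat (quatEquiv.symm p) = p :=
    congrArg Subtype.val (quatEquiv.apply_symm_apply p)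
  exact (h _).trans rfl

/-- The homomorphism from the semidirect product to `B₄(S²)`. -/
noncomputable def ofSemidirect :
    SemidirectProduct (QuaternionGroup 2) (FreeGroup (Fin 2)) quatAction →* B4S2 :=
  SemidirectProduct.lift quat free fun w => by ext q; exact quat_quatAction w q

theorem ofSemidirect_injective : Function.Injective ofSemidirect := by
  refine (injective_iff_map_eq_one _).2 fun x hx => ?_
  have hx : quat x.left * free x.right = 1 := hx
  have hr : x.right = 1 := by
    have h := congrArg toMulAutFree hx
    rw [map_mul, toMulAutFree_quat, toMulAutFree_free, one_mul, map_one] at h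
    exact (map_eq_one_iff _ FreeGroup.conj_injective).1 h
  rw [hr, map_one, mul_one, map_eq_one_iff _ quat_injective] at hx
  exact SemidirectProduct.ext hx hr

theorem range_ofSemidirect : ofSemidirect.range = commutator B4S2 := by
  rw [le_antisymm commutator_le_quatFree quatFree_le_commutator]
  apply le_antisymm
  · rintro _ ⟨x, rfl⟩
    refine mul_mem ?_ ?_
    · have h : quat.range ≤ quatFree :=
        closure_quat ▸ Subgroup.closure_mono (by grind)
      exact h ⟨_, rfl⟩
    · have h : free.range ≤ quatFree := by
        refine FreeGroup.range_lift_le ?_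
        rintro _ ⟨i, rfl⟩
        fin_cases i
        exacts [freeX_mem, freeY_mem]
      exact h ⟨_, rfl⟩
  · rw [quatFree, Subgroup.closure_le]
    rintro _ (rfl | rfl | rfl | rfl)
    · exact ⟨.inl (.a 1), (SemidirectProduct.lift_inl ..).trans quat_a_one⟩
    · exact ⟨.inl (.xa 0), (SemidirectProduct.lift_inl ..).trans quat_xa_zero⟩
    · exact ⟨.inr (.of 0), (SemidirectProduct.lift_inr ..).trans free_of_zero⟩
    · exact ⟨.inr (.of 1), (SemidirectProduct.lift_inr ..).trans free_of_one⟩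

end B4S2

/-- The commutator subgroup of `B₄(S²)` is isomorphic to a semidirect
product `Q₈ ⋊ F₂` of the quaternion group of order `8` by a free group of rank `2`. -/
theorem commutator_b4S2_iso_Q8_semidirect_F2 :
    ∃ φ : FreeGroup (Fin 2) →* MulAut (QuaternionGroup 2),
      Nonempty ((commutator B4S2) ≃*
        SemidirectProduct (QuaternionGroup 2) (FreeGroup (Fin 2)) φ) := by
  exact ⟨B4S2.quatAction, ⟨((MonoidHom.ofInjective B4S2.ofSemidirect_injective).trans
    (MulEquiv.subgroupCongr B4S2.range_ofSemidirect)).symm⟩⟩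
end

section
/- If G is a subgroup of B₄(S²) that is isomorphic to SL(2, ZMod 3) (the binary tetrahedral group T*), then G is maximal as a virtually cyclic subgroup of B₄(S²): G is virtually cyclic (being finite), and every virtually cyclic subgroup of B₄(S²) containing G is equal to G. -/
/-- A group is *virtually cyclic* if it contains a cyclic subgroup of finite index. -/
def IsVirtuallyCyclic (G : Type*) [Group G] : Prop :=
  ∃ H : Subgroup G, IsCyclic H ∧ H.FiniteIndex

/-- A subgroup `H` of `G` is *maximal as a virtually cyclic subgroup* if `H` is virtually
cyclic and is not properly contained in any virtually cyclic subgroup of `G`. -/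
def IsMaximalVirtuallyCyclic {G : Type*} [Group G] (H : Subgroup G) : Prop :=
  IsVirtuallyCyclic H ∧ ∀ K : Subgroup G, IsVirtuallyCyclic K → H ≤ K → K = H

open scoped MatrixGroups

section QuaternionRelations

variable {B : Type*} [Group B] {a b c x y : B}

theorem conj_quaternion_of_braid (hac : a * c = c * a) (hab : a * b * a = b * a * b)
    (hbc : b * c * b = c * b * c) (hx : x = a * c⁻¹) (hy : y = b * x * b⁻¹) :
    a * x = x * a ∧ b * x = y * b ∧ a * y = y * x⁻¹ * a ∧ b * y = y * x⁻¹ * y * b := by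
  have hax : a * x = x * a := by
    have : a * c⁻¹ = c⁻¹ * a := (Commute.inv_right (show Commute a c from hac)).eq
    rw [hx, mul_assoc a c⁻¹ a, ← this]
  have hbx : b * x = y * b := by rw [hy]; group
  have hbc' : b * c⁻¹ * b⁻¹ = c⁻¹ * b⁻¹ * c := by
    calc b * c⁻¹ * b⁻¹ = c⁻¹ * b⁻¹ * (b * c * b) * c⁻¹ * b⁻¹ := by group
      _ = c⁻¹ * b⁻¹ * c := by rw [hbc]; group
  have hay : a * y = y * x⁻¹ * a := by
    calc a * y = (a * b * a) * c⁻¹ * b⁻¹ := by rw [hy, hx]; group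
      _ = b * a * (b * c⁻¹ * b⁻¹) := by rw [hab]; group
      _ = b * (a * c⁻¹) * b⁻¹ * c := by rw [hbc']; group
      _ = y * c := by rw [hy, hx]
      _ = y * x⁻¹ * a := by rw [hx]; group
  refine ⟨hax, hbx, hay, ?_⟩
  have h1 : a * b * a * x = y * x⁻¹ * (a * b * a) := by
    calc a * b * a * x = a * (b * x) * a := by rw [mul_assoc (a * b), hax]; group
      _ = (a * y) * b * a := by rw [hbx]; group
      _ = _ := by rw [hay]; group
  have h2 : b * a * b * x = b * y * b⁻¹ * y⁻¹ * (b * a * b) := by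
    calc b * a * b * x = b * a * (b * x) := by group
      _ = b * (a * y) * b := by rw [hbx]; group
      _ = b * y * (b * x)⁻¹ * (b * a * b) := by rw [hay]; group
      _ = _ := by rw [hbx]; group
  rw [← hab, h1] at h2
  have h3 := mul_right_cancel h2
  calc b * y = (b * y * b⁻¹ * y⁻¹) * y * b := by group
    _ = _ := by rw [← h3]

theorem quaternion_of_sphere_braid (hac : a * c = c * a) (hab : a * b * a = b * a * b)
    (hbc : b * c * b = c * b * c) (hsph : a * b * c ^ 2 * b * a = 1)
    (hx : x = a * c⁻¹) (hy : y = b * x * b⁻¹) :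
    x ^ 2 = (a * b * a) ^ 2 ∧ y ^ 2 = x ^ 2 ∧ y * x = x⁻¹ * y ∧ x ^ 4 = 1 := by
  obtain ⟨hax, hbx, hay, hby⟩ := conj_quaternion_of_braid hac hab hbc hx hy
  set D := (a * b * a) ^ 2 with hD
  have hΔa : a * b * a * a = b * (a * b * a) := by
    nth_rw 1 [hab]; simp only [mul_assoc]
  have hΔb : a * b * a * b = a * (a * b * a) := by
    nth_rw 2 [hab]; simp only [mul_assoc]
  have hDa : D * a = a * D := by
    rw [hD, sq, mul_assoc, hΔa, ← mul_assoc, hΔb, mul_assoc]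
  have hDb : D * b = b * D := by
    rw [hD, sq, mul_assoc, hΔb, ← mul_assoc, hΔa, mul_assoc]
  have hD1 : D = (y * x⁻¹) ^ 2 := by
    have h1 : a * b * x = y * x⁻¹ * (a * b) := by
      rw [mul_assoc, hbx, ← mul_assoc, hay, mul_assoc]
    have h2 : a * b * x⁻¹ = (y * x⁻¹)⁻¹ * (a * b) := by
      calc a * b * x⁻¹ = (y * x⁻¹)⁻¹ * (y * x⁻¹ * (a * b)) * x⁻¹ := by group
        _ = _ := by rw [← h1]; group
    have hc : c = x⁻¹ * a := by rw [hx]; group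
    have hc2 : c ^ 2 = x⁻¹ * x⁻¹ * a * a := by
      calc c ^ 2 = x⁻¹ * (a * x⁻¹) * a := by rw [hc, sq]; group
        _ = x⁻¹ * (x⁻¹ * a) * a := by rw [(Commute.inv_right (show Commute a x from hax)).eq]
        _ = _ := by group
    have h3 : (y * x⁻¹)⁻¹ * (y * x⁻¹)⁻¹ * D = 1 := by
      calc (y * x⁻¹)⁻¹ * (y * x⁻¹)⁻¹ * D
          = (y * x⁻¹)⁻¹ * ((y * x⁻¹)⁻¹ * (a * b)) * (a * a * b * a) := by
            rw [hD, sq]; simp only [mul_assoc]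
        _ = (y * x⁻¹)⁻¹ * (a * b * x⁻¹) * (a * a * b * a) := by rw [h2]
        _ = (y * x⁻¹)⁻¹ * (a * b) * (x⁻¹ * a * a * b * a) := by
            simp only [mul_assoc]
        _ = a * b * x⁻¹ * (x⁻¹ * a * a * b * a) := by rw [h2]
        _ = a * b * (x⁻¹ * x⁻¹ * a * a) * b * a := by simp only [mul_assoc]
        _ = 1 := by rw [← hc2, hsph]
    rw [← mul_inv_rev] at h3
    rw [sq]
    exact (inv_mul_eq_one.mp h3).symm
  have hD2 : D = y ^ 2 := by
    refine mul_left_cancel (a := a) ?_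
    rw [← hDa, hD1, sq, sq, ← mul_assoc a, hay, mul_assoc _ a, hay]
    simp only [mul_assoc]
  have hD3 : D = x ^ 2 := by
    refine mul_left_cancel (a := b) ?_
    rw [← hDb, hD2, sq, sq, ← mul_assoc b, hbx, mul_assoc _ b, hbx]
    simp only [mul_assoc]
  have h : y * x = x⁻¹ * y := by
    have h1 : y * x⁻¹ * y * x⁻¹ = y * y := by rw [← sq y, ← hD2, hD1, sq]; simp only [mul_assoc]
    have h2 : x⁻¹ * (y * x⁻¹) = y := mul_left_cancel (a := y) (by simpa only [mul_assoc] using h1)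
    calc y * x = x⁻¹ * (y * x⁻¹) * x := by rw [h2]
      _ = x⁻¹ * y := by group
  refine ⟨hD3.symm, hD2.symm.trans hD3, h, ?_⟩
  have h1 : y * x ^ 2 = x⁻¹ * x⁻¹ * y := by
    rw [sq, ← mul_assoc, h, mul_assoc, h, mul_assoc]
  have h2 : y * x ^ 2 = x ^ 2 * y := by
    rw [← hD3, hD2, sq, mul_assoc]
  have h3 := mul_right_cancel (h2.symm.trans h1)
  calc x ^ 4 = x ^ 2 * x ^ 2 := by rw [← pow_add]
    _ = 1 := by nth_rw 1 [h3]; group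

theorem mem_closure_quaternion {n : B} (hxy : y ^ 2 = x ^ 2) (hyx : y * x = x⁻¹ * y)
    (hn : n ∈ Subgroup.closure {x, y}) :
    ∃ i : ℤ, n = x ^ i ∨ n = x ^ i * y := by
  have hyxi : y * x⁻¹ = x * y := by
    calc y * x⁻¹ = x * (x⁻¹ * y) * x⁻¹ := by group
      _ = x * y := by rw [← hyx]; group
  have hyz (i : ℤ) : y * x ^ i = x ^ (-i) * y := by
    have : y * x * y⁻¹ = x⁻¹ := by rw [hyx]; group
    calc y * x ^ i = (y * x * y⁻¹) ^ i * y := by rw [conj_zpow]; group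
      _ = x ^ (-i) * y := by rw [this]; group
  have hyy : y * y = x ^ (2 : ℤ) := by rw [← sq, hxy]; norm_cast
  have hyinv : y⁻¹ = x ^ (2 : ℤ) * y := by
    rw [inv_eq_iff_mul_eq_one, ← mul_assoc, hyz, mul_assoc, hyy]; group
  have hyinv (i : ℤ) : y⁻¹ * x ^ i = x ^ (2 - i) * y := by
    rw [hyinv, mul_assoc, hyz, ← mul_assoc, ← zpow_add, sub_eq_add_neg]
  induction hn using Subgroup.closure_induction_left with
  | one => exact ⟨0, Or.inl (by simp)⟩
  | mul_left s hs m _ ih =>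
    obtain ⟨i, hi⟩ := ih
    rcases hs with rfl | rfl
    · refine ⟨1 + i, ?_⟩
      rcases hi with rfl | rfl
      · left; rw [zpow_one_add]
      · right; rw [zpow_one_add, mul_assoc]
    · rcases hi with rfl | rfl
      · exact ⟨-i, Or.inr (hyz i)⟩
      · exact ⟨-i + 2, Or.inl (by rw [← mul_assoc, hyz, mul_assoc, hyy, ← zpow_add])⟩
  | inv_mul_cancel s hs m _ ih =>
    obtain ⟨i, hi⟩ := ih
    rcases hs with rfl | rfl
    · refine ⟨-1 + i, ?_⟩
      rcases hi with rfl | rfl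
      · left; rw [zpow_add, zpow_neg_one]
      · right; rw [zpow_add, zpow_neg_one, mul_assoc]
    · rcases hi with rfl | rfl
      · exact ⟨2 - i, Or.inr (hyinv i)⟩
      · exact ⟨2 - i + 2, Or.inl (by rw [← mul_assoc, hyinv, mul_assoc, hyy, ← zpow_add])⟩

theorem closure_quaternion_subset (hxy : y ^ 2 = x ^ 2) (hyx : y * x = x⁻¹ * y)
    (hx4 : x ^ 4 = 1) :
    (Subgroup.closure {x, y} : Set B) ⊆
      Set.range fun p : Fin 4 × Bool => x ^ (p.1 : ℕ) * if p.2 then y else 1 := by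
  intro n hn
  obtain ⟨i, hi⟩ := mem_closure_quaternion hxy hyx hn
  have hmod : x ^ i = x ^ (i % 4).toNat := by
    rw [← zpow_natCast, Int.toNat_of_nonneg (Int.emod_nonneg _ (by norm_num))]
    conv_lhs => rw [← Int.emod_add_mul_ediv i 4, zpow_add, zpow_mul]
    norm_cast
    simp [hx4]
  have hlt : (i % 4).toNat < 4 := by omega
  rcases hi with rfl | rfl
  · exact ⟨(⟨_, hlt⟩, false), by simp [hmod]⟩
  · exact ⟨(⟨_, hlt⟩, true), by simp [hmod]⟩

theorem pow_four_of_mem_closure_quaternion {n : B} (hxy : y ^ 2 = x ^ 2)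
    (hyx : y * x = x⁻¹ * y) (hx4 : x ^ 4 = 1) (hn : n ∈ Subgroup.closure {x, y}) :
    n ^ 4 = 1 := by
  obtain ⟨i, rfl | rfl⟩ := mem_closure_quaternion hxy hyx hn
  · rw [← zpow_natCast, zpow_comm, zpow_natCast, hx4, one_zpow]
  · have : y * x ^ i * y⁻¹ = x ^ (-i) := by
      rw [← conj_zpow, hyx, mul_inv_cancel_right, inv_zpow']
    have h2 : (x ^ i * y) ^ 2 = x ^ 2 := by
      calc (x ^ i * y) ^ 2 = x ^ i * (y * x ^ i * y⁻¹) * y ^ 2 := by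
            rw [sq, sq]; group
        _ = x ^ 2 := by rw [this, hxy]; group
    rw [show 4 = 2 * 2 by norm_num, pow_mul, h2, ← pow_mul, hx4]

/-- In a quotient of `B₄(S²)`, the normal closure of `σ₁σ₃⁻¹` is a quotient of the quaternion
group, and it contains the square of the half twist on three strings. -/
theorem exists_normal_quaternion_subgroup (hgen : Subgroup.closure {a, b, c} = ⊤)
    (hac : a * c = c * a) (hab : a * b * a = b * a * b)
    (hbc : b * c * b = c * b * c) (hsph : a * b * c ^ 2 * b * a = 1) :
    ∃ N : Subgroup B, N.Normal ∧ Finite N ∧ Nat.card N ≤ 8 ∧ (∀ n ∈ N, n ^ 4 = 1) ∧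
      a * c⁻¹ ∈ N ∧ (a * b * a) ^ 2 ∈ N ∧
      N ≤ Subgroup.normalClosure {a * c⁻¹} := by
  obtain ⟨x, hx⟩ : ∃ x, x = a * c⁻¹ := ⟨_, rfl⟩
  obtain ⟨y, hy⟩ : ∃ y, y = b * x * b⁻¹ := ⟨_, rfl⟩
  obtain ⟨hax, hbx, hay, hby⟩ := conj_quaternion_of_braid hac hab hbc hx hy
  obtain ⟨hD, hxy, hyx, hx4⟩ := quaternion_of_sphere_braid hac hab hbc hsph hx hy
  have hsub := closure_quaternion_subset hxy hyx hx4
  set N := Subgroup.closure {x, y} with hN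
  have hxN : x ∈ N := Subgroup.subset_closure (by simp)
  have hyN : y ∈ N := Subgroup.subset_closure (by simp)
  have hfin : Finite N := ((Set.finite_range _).subset hsub).to_subtype
  have hnorm (g : B) (h1 : g * x * g⁻¹ ∈ N) (h2 : g * y * g⁻¹ ∈ N) :
      g ∈ Subgroup.normalizer (N : Set B) := by
    have hle : N ≤ N.comap (MulAut.conj g).toMonoidHom := by
      conv_lhs => rw [hN]
      rw [Subgroup.closure_le]
      rintro n (rfl | rfl)
      · simpa using h1
      · simpa using h2
    exact Subgroup.mem_normalizer_fintype fun n hn => hle hn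
  have ha : a ∈ Subgroup.normalizer (N : Set B) := by
    apply hnorm
    · rw [hax]; simpa
    · rw [hay]; simpa using N.mul_mem hyN (N.inv_mem hxN)
  have hb : b ∈ Subgroup.normalizer (N : Set B) := by
    apply hnorm
    · rw [hbx]; simpa
    · rw [hby]; simpa using N.mul_mem (N.mul_mem hyN (N.inv_mem hxN)) hyN
  have hc : c ∈ Subgroup.normalizer (N : Set B) := by
    rw [show c = x⁻¹ * a by rw [hx]; group]
    exact mul_mem (inv_mem (Subgroup.le_normalizer hxN)) ha
  have hNn : N.Normal := by
    rw [← Subgroup.normalizer_eq_top_iff, eq_top_iff, ← hgen, Subgroup.closure_le]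
    rintro g (rfl | rfl | rfl) <;> assumption
  refine ⟨N, hNn, hfin, ?_, fun n => pow_four_of_mem_closure_quaternion hxy hyx hx4,
    hx ▸ hxN, hD ▸ N.pow_mem hxN 2, ?_⟩
  · change Nat.card (N : Set B) ≤ 8
    rw [Nat.card_coe_set_eq]
    refine (Set.ncard_le_ncard hsub (Set.finite_range _)).trans ?_
    rw [← Set.image_univ]
    refine (Set.ncard_image_le Set.finite_univ).trans ?_
    simp [Set.ncard_univ]
  · have hxc : x ∈ Subgroup.normalClosure {a * c⁻¹} :=
      hx ▸ Subgroup.subset_normalClosure rfl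
    rw [hN, Subgroup.closure_le]
    rintro n (rfl | rfl)
    · exact hxc
    · exact hy ▸ Subgroup.normalClosure_normal.conj_mem _ hxc _

end QuaternionRelations

theorem exists_commute_of_virtuallyCyclic {K : Type*} [Group K] [Infinite K]
    (H : Subgroup K) [IsCyclic H] [H.FiniteIndex] (g : K) (hg : g ^ 3 = 1) :
    ∃ z : K, ¬ IsOfFinOrder z ∧ Commute g z := by
  obtain ⟨⟨z, hzH⟩, hz⟩ := IsCyclic.exists_generator (α := H)
  have hHz : H = Subgroup.zpowers z := by
    ext k
    constructor
    · intro hk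
      obtain ⟨n, hn⟩ := hz ⟨k, hk⟩
      exact ⟨n, congrArg Subtype.val hn⟩
    · rintro ⟨n, rfl⟩
      exact H.zpow_mem hzH n
  have hzinf : ¬ IsOfFinOrder z := by
    intro hfin
    have : Finite H := by
      rw [hHz]
      exact hfin.finite_zpowers
    have := H.finite_quotient_of_finiteIndex
    exact not_finite_iff_infinite.mpr ‹Infinite K› (Finite.of_subgroup_quotient H)
  obtain ⟨m, hm0, -, hm⟩ := Subgroup.exists_pow_mem_of_index_ne_zero
    (H := H) Subgroup.FiniteIndex.index_ne_zero (g * z * g⁻¹)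
  rw [hHz] at hm
  obtain ⟨l, hl⟩ := hm
  have key : ∀ k : ℤ, g * z ^ (m * k) * g⁻¹ = z ^ (l * k) := by
    intro k
    have : z ^ (l * k) = ((g * z * g⁻¹) ^ m) ^ k := by rw [← hl, zpow_mul]
    rw [this, conj_pow, conj_zpow, zpow_mul, zpow_natCast]
  have h1 := key (m * m)
  have h2 := key (m * l)
  have h3 := key (l * l)
  have h4 : z ^ ((m : ℤ) * (m * m)) = z ^ (l * (l * l)) := by
    have hg' : g * g * g = 1 := by rw [← hg, pow_three']
    calc z ^ ((m : ℤ) * (m * m))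
        = (g * g * g) * z ^ ((m : ℤ) * (m * m)) * (g * g * g)⁻¹ := by rw [hg']; group
      _ = g * (g * (g * z ^ ((m : ℤ) * (m * m)) * g⁻¹) * g⁻¹) * g⁻¹ := by group
      _ = z ^ (l * (l * l)) := by
        rw [h1, show l * ((m : ℤ) * m) = m * (m * l) by ring, h2,
          show l * ((m : ℤ) * l) = m * (l * l) by ring, h3]
  have h5 : (m : ℤ) = l := by
    have := injective_zpow_iff_not_isOfFinOrder.mpr hzinf h4
    have h : (m : ℤ) ^ 3 = l ^ 3 := by linarith
    exact (Odd.strictMono_pow (by decide : Odd 3)).injective h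
  refine ⟨z ^ m, fun h => hzinf (h.of_pow hm0.ne'), ?_⟩
  have := key 1
  rw [← h5, mul_one, zpow_natCast] at this
  exact mul_inv_eq_iff_eq_mul.mp this

namespace ModularGroup

theorem mem_center_SL_two_int {A : SL(2, ℤ)} :
    A ∈ Subgroup.center SL(2, ℤ) ↔ A = 1 ∨ A = -1 := by
  constructor
  · intro h
    obtain ⟨r, hr, hA⟩ := Matrix.SpecialLinearGroup.mem_center_iff.mp h
    have hr' : r = 1 ∨ r = -1 := by
      rw [Fintype.card_fin] at hr
      simpa using hr
    rcases hr' with rfl | rfl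
    · left; ext i j; simp [← hA]
    · right; ext i j; simp [← hA, Matrix.one_apply]
  · rintro (rfl | rfl)
    · exact Subgroup.one_mem _
    · exact Subgroup.mem_center_iff.mpr fun g => by simp

/-- The projection from `SL(2, ℤ)` to the modular group. -/
abbrev toPSL : SL(2, ℤ) →* PSL(2, ℤ) := QuotientGroup.mk' _

theorem toPSL_eq_iff {A B : SL(2, ℤ)} : toPSL A = toPSL B ↔ A = B ∨ A = -B := by
  rw [QuotientGroup.mk'_eq_mk']
  constructor
  · rintro ⟨z, hz, h⟩
    rcases mem_center_SL_two_int.mp hz with rfl | rfl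
    · left; simpa using h
    · right; rw [← h]; simp
  · rintro (rfl | rfl)
    · exact ⟨1, Subgroup.one_mem _, by simp⟩
    · exact ⟨-1, mem_center_SL_two_int.mpr (Or.inr rfl), by simp⟩

theorem toPSL_surjective : Function.Surjective toPSL := QuotientGroup.mk'_surjective _

variable {Q : Type*} [Group Q]

/-- A group element is positive if it is trivial or its image in the modular group is represented
by a nonnegative matrix other than the identity. -/
def IsPositive (f : Q →* PSL(2, ℤ)) (w : Q) : Prop :=
  w = 1 ∨ ∃ A : SL(2, ℤ), f w = toPSL A ∧ 0 ≤ A 0 0 ∧ 0 ≤ A 0 1 ∧ 0 ≤ A 1 0 ∧ 0 ≤ A 1 1 ∧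
    3 ≤ A 0 0 + A 0 1 + A 1 0 + A 1 1

/-- The matrix `(0, -1; 1, 1)`, of order six. -/
def R : SL(2, ℤ) := ⟨!![0, -1; 1, 1], by decide⟩

/-- The matrix `(1, 1; 0, 1)`. -/
def U : SL(2, ℤ) := ⟨!![1, 1; 0, 1], by decide⟩

/-- The matrix `(1, 0; 1, 1)`. -/
def L : SL(2, ℤ) := ⟨!![1, 0; 1, 1], by decide⟩

theorem S_mul_R : toPSL S * toPSL R = toPSL U := by
  rw [← map_mul, toPSL_eq_iff]; right; decide

theorem S_mul_R_sq : toPSL S * (toPSL R * toPSL R) = toPSL L := by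
  rw [← map_mul, ← map_mul, toPSL_eq_iff]; right; decide

theorem IsPositive.mul_left {f : Q →* PSL(2, ℤ)} {u w : Q} {M : SL(2, ℤ)}
    (hM : M = U ∨ M = L) (hu : f u = toPSL M) (hw : IsPositive f w) : IsPositive f (u * w) := by
  right
  rcases hw with rfl | ⟨A, hA, h00, h01, h10, h11, hsum⟩
  · refine ⟨M, by simpa using hu, ?_⟩
    rcases hM with rfl | rfl <;> decide
  · refine ⟨M * A, by rw [map_mul, map_mul, hu, hA], ?_⟩
    rcases hM with rfl | rfl <;>
      simp only [Matrix.SpecialLinearGroup.coe_mul, Matrix.mul_apply, Fin.sum_univ_two] <;>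
      simp [U, L] <;> omega

theorem IsPositive.eq_one {f : Q →* PSL(2, ℤ)} {w : Q} (hw : IsPositive f w) {M : SL(2, ℤ)}
    (hM : M = 1 ∨ M 0 0 * M 0 1 < 0 ∨ M 0 0 * M 1 0 < 0 ∨ M 0 1 * M 1 0 < 0)
    (h : f w = toPSL M) : w = 1 := by
  rcases hw with rfl | ⟨A, hA, h00, h01, h10, h11, hsum⟩
  · rfl
  exfalso
  rcases hM with rfl | hM
  · rcases toPSL_eq_iff.mp (hA.symm.trans h) with rfl | rfl <;> simp at h00 h01 h10 h11 hsum
  · have hA' := toPSL_eq_iff.mp (hA.symm.trans h)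
    have := mul_nonneg h00 h01
    have := mul_nonneg h00 h10
    have := mul_nonneg h01 h10
    rcases hA' with rfl | rfl
    · omega
    · simp at *
      omega

theorem isPositive_of_mem_closure {f : Q →* PSL(2, ℤ)} {s t w : Q} (hfs : f s = toPSL S)
    (hft : f t = toPSL R) (hw : w ∈ Submonoid.closure {s * t, s * (t * t)}) :
    IsPositive f w := by
  induction hw using Submonoid.closure_induction_left with
  | one => exact Or.inl rfl
  | mul_left u hu m _ ih =>
    rcases hu with rfl | rfl
    · exact ih.mul_left (Or.inl rfl) (by rw [map_mul, hfs, hft, S_mul_R])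
    · exact ih.mul_left (Or.inr rfl) (by rw [map_mul, map_mul, hfs, hft, S_mul_R_sq])

theorem exists_eq_pow_mul_pow {s t : Q} (hs : s * s = 1)
    (ht : t * t * t = 1) (hgen : Subgroup.closure {s, t} = ⊤) (q : Q) :
    ∃ w ∈ Submonoid.closure {s * t, s * (t * t)},
      ∃ i : Fin 3, ∃ j : Fin 2, q = t ^ (i : ℕ) * w * s ^ (j : ℕ) := by
  set M := Submonoid.closure {s * t, s * (t * t)} with hM
  have hU : s * t ∈ M := Submonoid.subset_closure (by simp)
  have hL : s * (t * t) ∈ M := Submonoid.subset_closure (by simp)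
  let X : Q → Prop := fun q => ∃ w ∈ M, ∃ i : Fin 3, ∃ j : Fin 2, q = t ^ (i : ℕ) * w * s ^ (j : ℕ)
  have hst (q : Q) : X q → X (t * q) := by
    rintro ⟨w, hw, i, j, rfl⟩
    refine ⟨w, hw, i + 1, j, ?_⟩
    fin_cases i
    · simp [mul_assoc]
    · simp [mul_assoc, sq]
    · simp [← mul_assoc, sq, ht]
  have hss (q : Q) : X q → X (s * q) := by
    rintro ⟨w, hw, i, j, rfl⟩
    fin_cases i
    · induction hw using Submonoid.closure_induction_left with
      | one =>
        refine ⟨1, M.one_mem, 0, j + 1, ?_⟩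
        fin_cases j <;> simp [hs]
      | mul_left u hu m hm _ =>
        rcases hu with rfl | rfl
        · exact ⟨m, hm, 1, j, by simp [← mul_assoc, hs]⟩
        · exact ⟨m, hm, 2, j, by simp [← mul_assoc, hs, sq]⟩
    · exact ⟨s * t * w, M.mul_mem hU hw, 0, j, by simp [mul_assoc]⟩
    · exact ⟨s * (t * t) * w, M.mul_mem hL hw, 0, j, by simp [mul_assoc, sq]⟩
  change X q
  have hq : q ∈ Subgroup.closure {s, t} := hgen ▸ Subgroup.mem_top q
  induction hq using Subgroup.closure_induction_left with
  | one => exact ⟨1, M.one_mem, 0, 0, by simp⟩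
  | mul_left u hu m _ ih =>
    rcases hu with rfl | rfl
    · exact hss _ ih
    · exact hst _ ih
  | inv_mul_cancel u hu m _ ih =>
    rcases hu with rfl | rfl
    · rw [inv_eq_of_mul_eq_one_left hs]; exact hss _ ih
    · rw [inv_eq_of_mul_eq_one_left ht, mul_assoc]
      exact hst _ (hst _ ih)

theorem injective_of_S_R {f : Q →* PSL(2, ℤ)} {s t : Q} (hs : s * s = 1)
    (ht : t * t * t = 1) (hgen : Subgroup.closure {s, t} = ⊤) (hfs : f s = toPSL S)
    (hft : f t = toPSL R) : Function.Injective f := by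
  rw [injective_iff_map_eq_one]
  intro q hq
  obtain ⟨w, hwM, i, j, rfl⟩ := exists_eq_pow_mul_pow hs ht hgen q
  have hw : IsPositive f w := isPositive_of_mem_closure hfs hft hwM
  have hfw : f w = toPSL ((R ^ (i : ℕ))⁻¹ * (S ^ (j : ℕ))⁻¹) := by
    rw [eq_comm, map_mul, map_inv, map_inv, map_pow, map_pow, ← hfs, ← hft, ← map_pow, ← map_pow,
      inv_mul_eq_iff_eq_mul, inv_eq_iff_mul_eq_one, mul_eq_one_comm, ← map_mul, ← map_mul, hq]
  have hw1 : w = 1 := hw.eq_one (by fin_cases i <;> fin_cases j <;> decide) hfw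
  subst hw1
  have h : (1 : SL(2, ℤ)) = (R ^ (i : ℕ))⁻¹ * (S ^ (j : ℕ))⁻¹ ∨
      (1 : SL(2, ℤ)) = -((R ^ (i : ℕ))⁻¹ * (S ^ (j : ℕ))⁻¹) := by
    rw [← toPSL_eq_iff, ← hfw, map_one, map_one]
  have hij : i = 0 ∧ j = 0 := by
    revert h
    fin_cases i <;> fin_cases j <;> decide
  simp [hij.1, hij.2]

/-- An element of `SL(2, ℤ)` whose cube is central and which is not itself central has
trace `1` or `-1`. -/
theorem trace_eq_of_pow_three {A : SL(2, ℤ)} (h3 : A * A * A = 1 ∨ A * A * A = -1)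
    (hA : ¬ (A = 1 ∨ A = -1)) :
    (A 0 0 + A 1 1 = 1 ∨ A 0 0 + A 1 1 = -1) ∧ A 0 1 ≠ 0 := by
  have hdet := A.det_coe
  rw [Matrix.det_fin_two] at hdet
  have hA' : ¬ (A 0 1 = 0 ∧ A 1 0 = 0 ∧ A 0 0 = A 1 1) := by
    rintro ⟨h01, h10, h00⟩
    rw [h01, h00, zero_mul, sub_zero] at hdet
    refine hA ((mul_self_eq_one_iff.mp hdet).imp (fun h11 => ?_) fun h11 => ?_) <;>
    · rw [Matrix.SpecialLinearGroup.ext_iff]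
      simp [Fin.forall_fin_two, h00, h01, h10, h11]
  have h : A 0 1 * ((A 0 0 + A 1 1) ^ 2 - 1) = 0 ∧ A 1 0 * ((A 0 0 + A 1 1) ^ 2 - 1) = 0 ∧
      (A 0 0 - A 1 1) * ((A 0 0 + A 1 1) ^ 2 - 1) = 0 := by
    have h01 : (A * A * A) 0 1 = 0 := by rcases h3 with h | h <;> simp [h]
    have h10 : (A * A * A) 1 0 = 0 := by rcases h3 with h | h <;> simp [h]
    have h00 : (A * A * A) 0 0 = (A * A * A) 1 1 := by rcases h3 with h | h <;> simp [h]
    simp only [Matrix.SpecialLinearGroup.coe_mul, Matrix.mul_apply, Fin.sum_univ_two]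
      at h01 h10 h00
    refine ⟨?_, ?_, ?_⟩
    · linear_combination h01 + A 0 1 * hdet
    · linear_combination h10 + A 1 0 * hdet
    · linear_combination h00 + (A 0 0 - A 1 1) * hdet
  have htr : (A 0 0 + A 1 1) ^ 2 - 1 = 0 := by
    by_contra hne
    simp only [mul_eq_zero, hne, or_false, sub_eq_zero] at h
    exact hA' h
  refine ⟨by simpa [sub_eq_zero] using htr, fun h0 => ?_⟩
  rw [h0] at hdet
  have : (A 0 0 - A 1 1) ^ 2 = -3 := by linear_combination htr - 4 * hdet
  nlinarith [sq_nonneg (A 0 0 - A 1 1)]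

/-- The centralizer of an elliptic element of order three in `PSL(2, ℤ)`, upstairs. -/
theorem eq_of_commute {A H : SL(2, ℤ)} (htr : A 0 0 + A 1 1 = 1 ∨ A 0 0 + A 1 1 = -1)
    (hb : A 0 1 ≠ 0) (hcomm : A * H = H * A) :
    H = 1 ∨ H = -1 ∨ H = A ∨ H = -A ∨ H = A * A ∨ H = -(A * A) := by
  have hdetA := A.det_coe
  have hdetH := H.det_coe
  rw [Matrix.det_fin_two] at hdetA hdetH
  have h00 : (A * H) 0 0 = (H * A) 0 0 := by rw [hcomm]
  have h01 : (A * H) 0 1 = (H * A) 0 1 := by rw [hcomm]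
  simp only [Matrix.SpecialLinearGroup.coe_mul, Matrix.mul_apply, Fin.sum_univ_two] at h00 h01
  have hext (B : SL(2, ℤ)) : H = B ↔
      H 0 0 = B 0 0 ∧ H 0 1 = B 0 1 ∧ H 1 0 = B 1 0 ∧ H 1 1 = B 1 1 := by
    rw [Matrix.SpecialLinearGroup.ext_iff]
    simp [Fin.forall_fin_two, and_assoc]
  simp only [hext, Matrix.SpecialLinearGroup.coe_mul, Matrix.mul_apply, Fin.sum_univ_two,
    Matrix.SpecialLinearGroup.coe_one, Matrix.SpecialLinearGroup.coe_neg, Matrix.neg_apply,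
    Matrix.one_apply]
  generalize A 0 0 = a at *
  generalize A 0 1 = b at *
  generalize A 1 0 = c at *
  generalize A 1 1 = d at *
  generalize H 0 0 = p at *
  generalize H 0 1 = q at *
  generalize H 1 0 = r at *
  generalize H 1 1 = u at *
  have htr2 : (a + d) ^ 2 = 1 := by rcases htr with h | h <;> rw [h] <;> norm_num
  have hquad : 3 * q ^ 2 = b ^ 2 * (4 - (p + u) ^ 2) := by
    linear_combination 4 * b ^ 2 * hdetH - 4 * q ^ 2 * hdetA + q ^ 2 * htr2 + 4 * b * q * h00 -
      (b * (p - u) + q * (a - d)) * h01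
  have hb2 : 0 < b ^ 2 := by positivity
  have hτ : (p + u) ^ 2 ≤ 2 ^ 2 := by
    by_contra! hlt
    nlinarith [sq_nonneg q]
  obtain ⟨hτ1, hτ2⟩ := abs_le.mp (abs_le_of_sq_le_sq hτ (by norm_num))
  have hu : u = (p + u) - p := by ring
  generalize p + u = τ at *
  subst hu
  have hq0 (h : τ ^ 2 = 4) : q = 0 := by
    rw [h] at hquad
    simpa using hquad
  have hqb (h : τ ^ 2 = 1) : q = b ∨ q = -b := by
    rw [h] at hquad
    exact sq_eq_sq_iff_eq_or_eq_neg.mp (by linarith)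
  have hne (h : τ = 0) : False := by
    subst h
    have hq : (q : ℚ) ≠ 0 := by
      rintro hq
      have : q = 0 := by exact_mod_cast hq
      subst this
      omega
    have : IsSquare (3 : ℚ) := by
      refine ⟨2 * b / q, ?_⟩
      field_simp
      have : (3 : ℚ) * q ^ 2 = b ^ 2 * (4 - 0 ^ 2) := by exact_mod_cast hquad
      linarith
    revert this
    norm_num
  have hcases : τ = 2 ∨ τ = -2 ∨ τ = 1 ∨ τ = -1 := by
    have : τ ≠ 0 := hne
    omega
  rcases hcases with rfl | rfl | hτ'
  · obtain rfl := hq0 rfl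
    have hr : r = 0 := mul_left_cancel₀ hb (by linear_combination h00)
    have hp : p = 1 := mul_left_cancel₀ hb (by linarith)
    left
    simp [hr, hp]
  · obtain rfl := hq0 rfl
    have hr : r = 0 := mul_left_cancel₀ hb (by linear_combination h00)
    have hp : p = -1 := mul_left_cancel₀ hb (by linarith)
    right; left
    simp [hr, hp]
  · rcases hqb (by rcases hτ' with rfl | rfl <;> norm_num) with rfl | rfl
    · have hr : r = c := mul_left_cancel₀ hb (by linear_combination h00)
      have hp : 2 * p = τ + (a - d) := mul_left_cancel₀ hb (by linear_combination -h01)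
      rcases hτ' with rfl | rfl <;> rcases htr with htr | htr <;>
        obtain rfl := eq_sub_of_add_eq' htr <;> subst hr
      · right; right; left
        grind
      · right; right; right; right; right
        grind
      · right; right; right; right; left
        grind
      · right; right; left
        grind
    · have hr : r = -c := mul_left_cancel₀ hb (by linear_combination h00)
      have hp : 2 * p = τ - (a - d) := mul_left_cancel₀ hb (by linear_combination -h01)
      rcases hτ' with rfl | rfl <;> rcases htr with htr | htr <;>
        obtain rfl := eq_sub_of_add_eq' htr <;> subst hr
      · right; right; right; right; right
        grind
      · right; right; right; left
        grind
      · right; right; right; left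
        grind
      · right; right; right; right; left
        grind

theorem trace_eq_zero_of_anticommute {A H : SL(2, ℤ)} (h : A * H = -(H * A)) :
    A 0 0 + A 1 1 = 0 := by
  have h1 : (A : Matrix (Fin 2) (Fin 2) ℤ).trace = -(A : Matrix (Fin 2) (Fin 2) ℤ).trace := by
    have h2 : A = -(H * A * H⁻¹) := by rw [← neg_mul, ← h, mul_inv_cancel_right]
    conv_lhs => rw [h2]
    rw [Matrix.SpecialLinearGroup.coe_neg, Matrix.trace_neg, Matrix.SpecialLinearGroup.coe_mul,
      Matrix.trace_mul_comm, ← Matrix.SpecialLinearGroup.coe_mul, inv_mul_cancel_left]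
  rw [Matrix.trace_fin_two] at h1
  omega

theorem eq_of_commute_PSL {g q : PSL(2, ℤ)} (hg3 : g ^ 3 = 1) (hg : g ≠ 1) (hq : Commute g q) :
    q = 1 ∨ q = g ∨ q = g ^ 2 := by
  obtain ⟨A, rfl⟩ := toPSL_surjective g
  obtain ⟨H, rfl⟩ := toPSL_surjective q
  obtain ⟨htr, hb⟩ := trace_eq_of_pow_three (A := A)
    (by rw [← toPSL_eq_iff, map_mul, map_mul, map_one, ← hg3, pow_three'])
    (by rwa [← toPSL_eq_iff, map_one])
  have hcomm : toPSL (A * H) = toPSL (H * A) := by simpa only [map_mul] using hq.eq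
  rcases toPSL_eq_iff.mp hcomm with h | h
  · have := eq_of_commute htr hb h
    rw [← map_one toPSL, ← map_pow, toPSL_eq_iff, toPSL_eq_iff, toPSL_eq_iff, sq]
    tauto
  · have := trace_eq_zero_of_anticommute h
    omega

/-- The positive definite form `AᵀA` attached to a class of matrices modulo sign. -/
noncomputable def gram (q : PSL(2, ℤ)) : Matrix (Fin 2) (Fin 2) ℤ :=
  let A : SL(2, ℤ) := Quotient.out q
  (A : Matrix (Fin 2) (Fin 2) ℤ).transpose * (A : Matrix (Fin 2) (Fin 2) ℤ)

theorem gram_toPSL (A : SL(2, ℤ)) :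
    gram (toPSL A) = (A : Matrix (Fin 2) (Fin 2) ℤ).transpose * (A : Matrix (Fin 2) (Fin 2) ℤ) := by
  have h : toPSL (Quotient.out (toPSL A)) = toPSL A := Quotient.out_eq _
  rw [gram]
  rcases toPSL_eq_iff.mp h with h | h <;> rw [h]
  simp

theorem gram_mul_toPSL (q : PSL(2, ℤ)) (A : SL(2, ℤ)) :
    gram (q * toPSL A) = (A : Matrix (Fin 2) (Fin 2) ℤ).transpose * gram q * A := by
  obtain ⟨B, rfl⟩ := toPSL_surjective q
  rw [← map_mul, gram_toPSL, gram_toPSL, Matrix.SpecialLinearGroup.coe_mul, Matrix.transpose_mul]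
  simp only [Matrix.mul_assoc]

theorem exists_invariant_form (F : Subgroup PSL(2, ℤ)) [Finite F] :
    ∃ p q r : ℤ, 0 < p ∧ 0 < r ∧ ∀ A : SL(2, ℤ), toPSL A ∈ F →
      (A : Matrix (Fin 2) (Fin 2) ℤ).transpose * !![p, q; q, r] * A = !![p, q; q, r] := by
  have := Fintype.ofFinite F
  let G : Matrix (Fin 2) (Fin 2) ℤ := ∑ x : F, gram x
  have hsymm : G.transpose = G := by
    simp [G, Matrix.transpose_sum, gram]
  have hpos (i : Fin 2) : 0 < G i i := by
    simp only [G, Matrix.sum_apply]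
    refine Finset.sum_pos (fun x _ => ?_) Finset.univ_nonempty
    obtain ⟨A, hA⟩ := toPSL_surjective x
    have hdet := A.det_coe
    rw [Matrix.det_fin_two] at hdet
    rw [← hA, gram_toPSL]
    simp only [Matrix.mul_apply, Matrix.transpose_apply, Fin.sum_univ_two]
    by_contra! hle
    have h0 : A 0 i = 0 := by nlinarith [mul_self_nonneg (A 0 i), mul_self_nonneg (A 1 i)]
    have h1 : A 1 i = 0 := by nlinarith [mul_self_nonneg (A 0 i), mul_self_nonneg (A 1 i)]
    fin_cases i <;> simp_all
  have hG : G = !![G 0 0, G 0 1; G 0 1, G 1 1] := by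
    rw [← Matrix.ext_iff]
    have : G 1 0 = G 0 1 := congrFun₂ hsymm 0 1
    simp [Fin.forall_fin_two, this]
  refine ⟨G 0 0, G 0 1, G 1 1, hpos 0, hpos 1, fun A hA => ?_⟩
  rw [← hG]
  calc (A : Matrix (Fin 2) (Fin 2) ℤ).transpose * G * A
      = ∑ x : F, gram (x * toPSL A) := by
        simp only [gram_mul_toPSL, G, Matrix.mul_sum, Matrix.sum_mul]
    _ = G := Fintype.sum_equiv (Equiv.mulRight (⟨toPSL A, hA⟩ : F)) _ _ fun x => rfl

/-- Finite subgroups of the modular group are commutative. -/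
theorem commute_of_finite (F : Subgroup PSL(2, ℤ)) [Finite F] {g h : PSL(2, ℤ)} (hg : g ∈ F)
    (hh : h ∈ F) : Commute g h := by
  obtain ⟨p, q, r, hp, hr, hF⟩ := exists_invariant_form F
  obtain ⟨A, rfl⟩ := toPSL_surjective g
  obtain ⟨B, rfl⟩ := toPSL_surjective h
  have hlin (M : SL(2, ℤ)) (hM : toPSL M ∈ F) :
      p * (M 0 0 - M 1 1) = -2 * q * M 1 0 ∧ p * M 0 1 = -r * M 1 0 := by
    have hdet := M.det_coe
    rw [Matrix.det_fin_two] at hdet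
    have e00 := congrFun₂ (hF M hM) 0 0
    have e01 := congrFun₂ (hF M hM) 0 1
    have e11 := congrFun₂ (hF M hM) 1 1
    simp [Matrix.mul_apply, Fin.sum_univ_two] at e00 e01 e11
    constructor
    · linear_combination M 1 1 * e00 - M 1 0 * e01 - (p * M 0 0 + q * M 1 0) * hdet
    · linear_combination M 1 1 * e01 - M 1 0 * e11 - (p * M 0 1 + q * M 1 1) * hdet
  obtain ⟨hA1, hA2⟩ := hlin A hg
  obtain ⟨hB1, hB2⟩ := hlin B hh
  have hp2 : p ^ 2 ≠ 0 := by positivity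
  suffices A * B = B * A by
    rw [commute_iff_eq, ← map_mul, this, map_mul]
  have h1 : A 0 1 * B 1 0 = B 0 1 * A 1 0 :=
    mul_left_cancel₀ hp.ne' (by linear_combination B 1 0 * hA2 - A 1 0 * hB2)
  have h2 : (A 0 0 - A 1 1) * B 1 0 = (B 0 0 - B 1 1) * A 1 0 :=
    mul_left_cancel₀ hp.ne' (by linear_combination B 1 0 * hA1 - A 1 0 * hB1)
  have h3 : (A 0 0 - A 1 1) * B 0 1 = (B 0 0 - B 1 1) * A 0 1 :=
    mul_left_cancel₀ hp2 (by
      linear_combination p * B 0 1 * hA1 - 2 * q * A 1 0 * hB2 - p * A 0 1 * hB1 +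
        2 * q * B 1 0 * hA2)
  rw [Matrix.SpecialLinearGroup.ext_iff]
  simp only [Matrix.SpecialLinearGroup.coe_mul, Matrix.mul_apply, Fin.sum_univ_two,
    Fin.forall_fin_two]
  refine ⟨⟨?_, ?_⟩, ?_, ?_⟩
  · linear_combination h1
  · linear_combination h3
  · linear_combination -h2
  · linear_combination -h1

end ModularGroup

section SphereBraidGroup

open ModularGroup

/-- The matrices representing the braid generators. -/
def braidMatrix : Fin 3 → SL(2, ℤ) :=
  ![⟨!![1, -1; 0, 1], by decide⟩, L, ⟨!![1, -1; 0, 1], by decide⟩]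

theorem lift_braidMatrix_eq_one (r : FreeGroup (Fin 3)) (hr : r ∈ sphereBraidRels) :
    FreeGroup.lift (fun i => toPSL (braidMatrix i)) r = 1 := by
  rcases hr with rfl | rfl | rfl | rfl <;>
  · simp only [map_mul, map_inv, map_pow, FreeGroup.lift_apply_of]
    simp only [← map_mul, ← map_inv, ← map_pow]
    rw [← map_one toPSL, toPSL_eq_iff]
    decide

/-- The homomorphism from `B₄(S²)` to the modular group. -/
def toModularGroup : B4S2 →* PSL(2, ℤ) :=
  PresentedGroup.toGroup lift_braidMatrix_eq_one

theorem toModularGroup_σ (i : Fin 3) : toModularGroup (σ i) = toPSL (braidMatrix i) :=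
  PresentedGroup.toGroup.of _

theorem closure_σ : Subgroup.closure {σ 0, σ 1, σ 2} = ⊤ := by
  rw [← PresentedGroup.closure_range_of sphereBraidRels]
  congr 1
  ext x
  simp [Fin.exists_fin_succ, σ, eq_comm]

theorem toModularGroup_ker :
    Finite toModularGroup.ker ∧ Nat.card toModularGroup.ker ≤ 8 ∧
      ∀ n ∈ toModularGroup.ker, n ^ 4 = 1 := by
  have hac : σ 0 * σ 2 = σ 2 * σ 0 := by
    rw [← mul_inv_eq_one]
    exact PresentedGroup.one_of_mem (rels := sphereBraidRels) (by simp [sphereBraidRels])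
  have hab : σ 0 * σ 1 * σ 0 = σ 1 * σ 0 * σ 1 := by
    rw [← mul_inv_eq_one]
    exact PresentedGroup.one_of_mem (rels := sphereBraidRels) (by simp [sphereBraidRels])
  have hbc : σ 1 * σ 2 * σ 1 = σ 2 * σ 1 * σ 2 := by
    rw [← mul_inv_eq_one]
    exact PresentedGroup.one_of_mem (rels := sphereBraidRels) (by simp [sphereBraidRels])
  have hsph : σ 0 * σ 1 * σ 2 ^ 2 * σ 1 * σ 0 = 1 :=
    PresentedGroup.one_of_mem (rels := sphereBraidRels) (by simp [sphereBraidRels])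
  obtain ⟨N, hNn, hNfin, hN8, hN4, hxN, hDN, hNle⟩ :=
    exists_normal_quaternion_subgroup closure_σ hac hab hbc hsph
  have hNker : N ≤ toModularGroup.ker := by
    refine hNle.trans (Subgroup.normalClosure_le_normal ?_)
    rintro _ rfl
    simp [MonoidHom.mem_ker, toModularGroup_σ, braidMatrix]
  have hkerN : toModularGroup.ker = N := by
    refine le_antisymm (fun n hn => ?_) hNker
    let f : B4S2 ⧸ N →* PSL(2, ℤ) := QuotientGroup.lift N toModularGroup hNker
    let π : B4S2 →* B4S2 ⧸ N := QuotientGroup.mk' N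
    have hf (b : B4S2) : f (π b) = toModularGroup b := rfl
    have hinj : Function.Injective f := by
      refine injective_of_S_R (s := π (σ 0 * σ 1 * σ 0)) (t := π (σ 0 * σ 1)) ?_ ?_ ?_ ?_ ?_
      · rw [← map_mul, ← sq]
        exact (QuotientGroup.eq_one_iff _).mpr hDN
      · rw [← map_mul, ← map_mul]
        refine (QuotientGroup.eq_one_iff _).mpr ?_
        rwa [show σ 0 * σ 1 * (σ 0 * σ 1) * (σ 0 * σ 1) = (σ 0 * σ 1 * σ 0) ^ 2 by
          rw [sq]; nth_rw 2 [hab]; simp only [mul_assoc]]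
      · set C := Subgroup.closure {π (σ 0 * σ 1 * σ 0), π (σ 0 * σ 1)}
        have hs : π (σ 0 * σ 1 * σ 0) ∈ C := Subgroup.subset_closure (by simp)
        have ht : π (σ 0 * σ 1) ∈ C := Subgroup.subset_closure (by simp)
        have h0 : π (σ 0) ∈ C := by
          have := C.mul_mem (C.inv_mem ht) hs
          rwa [← map_inv, ← map_mul, inv_mul_cancel_left] at this
        have h1 : π (σ 1) ∈ C := by
          have := C.mul_mem (C.inv_mem h0) ht
          rwa [← map_inv, ← map_mul, inv_mul_cancel_left] at this
        have h2 : π (σ 2) ∈ C := by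
          rwa [← show π (σ 0) = π (σ 2) from ?_]
          rw [← mul_inv_eq_one, ← map_inv, ← map_mul]
          exact (QuotientGroup.eq_one_iff _).mpr hxN
        have hle : (⊤ : Subgroup B4S2) ≤ C.comap π := by
          rw [← closure_σ, Subgroup.closure_le]
          rintro _ (rfl | rfl | rfl) <;> assumption
        rw [eq_top_iff]
        rintro q -
        obtain ⟨b, rfl⟩ := QuotientGroup.mk'_surjective N q
        exact hle (Subgroup.mem_top b)
      · rw [hf, map_mul, map_mul, toModularGroup_σ, toModularGroup_σ, ← map_mul, ← map_mul,
          toPSL_eq_iff]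
        decide
      · rw [hf, map_mul, toModularGroup_σ, toModularGroup_σ, ← map_mul, toPSL_eq_iff]
        decide
    exact (QuotientGroup.eq_one_iff _).mp (hinj ((hf n).trans (hn.trans (map_one f).symm)))
  rw [hkerN]
  exact ⟨hNfin, hN8, hN4⟩

theorem toModularGroup_ne_one {g : B4S2} (hg3 : g ^ 3 = 1) (hg : g ≠ 1) :
    toModularGroup g ≠ 1 := fun h => hg <| by
  have h4 := toModularGroup_ker.2.2 g h
  rwa [pow_succ, hg3, one_mul] at h4

/-- An element of `B₄(S²)` commuting with an element of order three has finite order. -/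
theorem isOfFinOrder_of_commute {g z : B4S2} (hg3 : g ^ 3 = 1) (hg : g ≠ 1)
    (hz : Commute g z) : IsOfFinOrder z := by
  have hg3' : toModularGroup g ^ 3 = 1 := by rw [← map_pow, hg3, map_one]
  have hz3 : toModularGroup (z ^ 3) = 1 := by
    rw [map_pow]
    rcases eq_of_commute_PSL hg3' (toModularGroup_ne_one hg3 hg) (hz.map toModularGroup)
      with h | h | h <;> rw [h]
    · exact one_pow 3
    · exact hg3'
    · rw [pow_right_comm, hg3', one_pow]
  have h12 := toModularGroup_ker.2.2 _ hz3
  rw [← pow_mul] at h12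
  exact isOfFinOrder_iff_pow_eq_one.mpr ⟨12, by norm_num, h12⟩

/-- A virtually cyclic subgroup of `B₄(S²)` with an element of order three is finite of order at
most `24`. -/
theorem card_le_of_virtuallyCyclic (K : Subgroup B4S2) (hK : IsVirtuallyCyclic K) {g : B4S2}
    (hgK : g ∈ K) (hg3 : g ^ 3 = 1) (hg : g ≠ 1) : Finite K ∧ Nat.card K ≤ 24 := by
  have hfin : Finite K := by
    by_contra hinf
    rw [not_finite_iff_infinite] at hinf
    obtain ⟨H, hH, hHfin⟩ := hK
    obtain ⟨z, hz, hcomm⟩ := exists_commute_of_virtuallyCyclic H ⟨g, hgK⟩ (Subtype.ext hg3)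
    refine hz ?_
    rw [← Submonoid.isOfFinOrder_coe]
    exact isOfFinOrder_of_commute hg3 hg (congrArg Subtype.val hcomm.eq)
  refine ⟨hfin, ?_⟩
  obtain ⟨hNfin, hN8, -⟩ := toModularGroup_ker
  have hg3' : toModularGroup g ^ 3 = 1 := by rw [← map_pow, hg3, map_one]
  have himage : Nat.card (K.map toModularGroup) ≤ 3 := by
    have hFfin : Finite (K.map toModularGroup) := Set.Finite.image _ (Set.toFinite (K : Set B4S2))
    have hsub : (K.map toModularGroup : Set PSL(2, ℤ)) ⊆
        Set.range fun i : Fin 3 => toModularGroup g ^ (i : ℕ) := by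
      intro q hq
      rcases eq_of_commute_PSL hg3' (toModularGroup_ne_one hg3 hg)
        (commute_of_finite _ (Subgroup.mem_map_of_mem _ hgK) hq) with h | h | h
      · exact ⟨0, by simp [h]⟩
      · exact ⟨1, by simp [h]⟩
      · exact ⟨2, by simp [h]⟩
    change Nat.card (K.map toModularGroup : Set PSL(2, ℤ)) ≤ 3
    rw [Nat.card_coe_set_eq]
    refine (Set.ncard_le_ncard hsub (Set.finite_range _)).trans ?_
    rw [← Set.image_univ]
    refine (Set.ncard_image_le Set.finite_univ).trans ?_
    simp [Set.ncard_univ]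
  have hker : Nat.card (toModularGroup.subgroupMap K).ker ≤ 8 := by
    refine (Nat.card_le_card_of_injective
      (fun n => (⟨n.1, congrArg Subtype.val n.2⟩ : toModularGroup.ker)) ?_).trans hN8
    intro m n h
    exact Subtype.ext (Subtype.ext (congrArg (fun k : toModularGroup.ker => (k : B4S2)) h))
  have hcard := (toModularGroup.subgroupMap K).ker.card_mul_index
  rw [Subgroup.index_ker, MonoidHom.range_eq_top.mpr (toModularGroup.subgroupMap_surjective K),
    Subgroup.card_top] at hcard
  rw [← hcard]
  exact Nat.mul_le_mul hker himage

end SphereBraidGroup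

/-- Every subgroup of `B₄(S²)` isomorphic to the binary tetrahedral group
`T* = SL(2, ℤ/3)` is maximal as a virtually cyclic subgroup of `B₄(S²)`. -/
theorem tstar_subgroup_maximal_virtuallyCyclic (G : Subgroup B4S2)
    (hG : Nonempty (G ≃* Matrix.SpecialLinearGroup (Fin 2) (ZMod 3))) :
    IsVirtuallyCyclic G ∧
    ∀ K : Subgroup B4S2, IsVirtuallyCyclic K → G ≤ K → K = G := by
  obtain ⟨e⟩ := hG
  have hGfin : Finite G := Finite.of_equiv _ e.symm.toEquiv
  have hG24 : Nat.card G = 24 := by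
    rw [Nat.card_congr e.toEquiv, Nat.card_eq_fintype_card]
    decide +kernel
  refine ⟨⟨⊥, inferInstance, inferInstance⟩, fun K hK hGK => ?_⟩
  obtain ⟨g, hg⟩ := exists_prime_orderOf_dvd_card' (G := G) 3 (by rw [hG24]; norm_num)
  have hg3 : (g : B4S2) ^ 3 = 1 := by
    have := pow_orderOf_eq_one g
    rw [hg] at this
    exact_mod_cast this
  have hg1 : (g : B4S2) ≠ 1 := by
    intro h
    have : g = 1 := Subtype.ext h
    rw [this, orderOf_one] at hg
    norm_num at hg
  obtain ⟨hKfin, hK24⟩ := card_le_of_virtuallyCyclic K hK (hGK g.2) hg3 hg1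
  exact (Subgroup.eq_of_le_of_card_ge hGK (hG24 ▸ hK24)).symm
end
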